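/- Let q ∈ ℂ be not a root of unity (q^m ≠ 1 for every positive integer m). Let n ≥ 1 and let C₁₁, C₁₂, C₂₁, C₂₂ be n×n complex matrices satisfying the Dipper–Donkin quantum GL₂ relations, with the quantum determinant C₁₁C₂₂ − C₁₂C₂₁ invertible. Then the representation is simultaneously triangularizable: there exists an invertible n×n complex matrix u such that u C_{ij} u⁻¹ is upper triangular for all i,j ∈ {1,2}. -/

import Mathlib

namespace DipperDonkin

open Module

lemma exists_eig {V : Type} [AddCommGroup V] [Module ℂ V] [FiniteDimensional ℂ V]
    (W : Submodule ℂ V) (hW : W ≠ ⊥) (x : V →ₗ[ℂ] V) (hx : ∀ w ∈ W, x w ∈ W) :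
    ∃ μ : ℂ, ∃ w ∈ W, w ≠ 0 ∧ x w = μ • w := by
  have : Nontrivial W := Submodule.nontrivial_iff_ne_bot.mpr hW
  obtain ⟨μ, hμ⟩ := Module.End.exists_eigenvalue (x.restrict hx : Module.End ℂ W)
  obtain ⟨w, hw⟩ := hμ.exists_hasEigenvector
  refine ⟨μ, w, w.2, fun h => hw.2 (Subtype.ext h), ?_⟩
  have := congrArg Subtype.val hw.apply_eq_smul
  simpa using this

lemma exists_ker {V : Type} [AddCommGroup V] [Module ℂ V] [FiniteDimensional ℂ V]
    (q : ℂ) (hq : ∀ m : ℕ, 0 < m → q ^ m ≠ 1)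
    (W : Submodule ℂ V) (hW : W ≠ ⊥) (x D : V →ₗ[ℂ] V) (hx : ∀ w ∈ W, x w ∈ W)
    (hD : ∀ w ∈ W, D w ∈ W) (hDi : Function.Injective D)
    (h : (∀ w ∈ W, x (D w) = q • D (x w)) ∨ (∀ w ∈ W, D (x w) = q • x (D w))) :
    ∃ w ∈ W, w ≠ 0 ∧ x w = 0 := by
  have : Nontrivial W := Submodule.nontrivial_iff_ne_bot.mpr hW
  set x' : W →ₗ[ℂ] W := x.restrict hx with hx'
  set D' : W →ₗ[ℂ] W := D.restrict hD with hD'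
  have hdetD : LinearMap.det D' ≠ 0 := by
    intro h0
    obtain h1 := LinearMap.bot_lt_ker_of_det_eq_zero h0
    obtain ⟨w, hw, hw0⟩ := Submodule.exists_mem_ne_zero_of_ne_bot h1.ne'
    apply hw0
    have : D (w : V) = 0 := by
      have := congrArg Subtype.val (LinearMap.mem_ker.mp hw)
      simpa [hD'] using this
    exact Subtype.ext (hDi (by simpa using this))
  have hdet : LinearMap.det x' = 0 := by
    by_contra hne
    have hpos : 0 < finrank ℂ W := finrank_pos
    apply hq _ hpos
    rcases h with h | h
    · have e : x' * D' = q • (D' * x') := by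
        ext w
        simpa [hx', hD'] using h w w.2
      have := congrArg LinearMap.det e
      rw [LinearMap.det_smul, map_mul, map_mul] at this
      have h2 : LinearMap.det x' * LinearMap.det D' ≠ 0 := mul_ne_zero hne hdetD
      apply mul_right_cancel₀ h2
      rw [one_mul]; linear_combination -this
    · have e : D' * x' = q • (x' * D') := by
        ext w
        simpa [hx', hD'] using h w w.2
      have := congrArg LinearMap.det e
      rw [LinearMap.det_smul, map_mul, map_mul] at this
      have h2 : LinearMap.det x' * LinearMap.det D' ≠ 0 := mul_ne_zero hne hdetD
      apply mul_right_cancel₀ h2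
      rw [one_mul, ← this]; ring
  obtain ⟨w, hw, hw0⟩ := Submodule.exists_mem_ne_zero_of_ne_bot
    (LinearMap.bot_lt_ker_of_det_eq_zero hdet).ne'
  refine ⟨w, w.2, fun h => hw0 (Subtype.ext h), ?_⟩
  have := congrArg Subtype.val (LinearMap.mem_ker.mp hw)
  simpa [hx'] using this

structure Rel (q : ℂ) {V : Type} [AddCommGroup V] [Module ℂ V]
    (a b c d E : V →ₗ[ℂ] V) : Prop where
  h1 : ∀ v, a (b v) = b (a v)
  h2 : ∀ v, c (a v) = q • a (c v)
  h3 : ∀ v, d (b v) = q • b (d v)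
  h4 : ∀ v, c (d v) = d (c v)
  h5 : ∀ v, c (b v) = q • b (c v)
  h6 : ∀ v, d (a v) - a (d v) = (q - 1) • b (c v)
  hE : ∀ v, a (d (E v)) - b (c (E v)) = v

lemma common_eig {V : Type} [AddCommGroup V] [Module ℂ V] [FiniteDimensional ℂ V] [Nontrivial V]
    (q : ℂ) (hq : ∀ m : ℕ, 0 < m → q ^ m ≠ 1) {a b c d E : V →ₗ[ℂ] V} (H : Rel q a b c d E) :
    ∃ v : V, v ≠ 0 ∧ (∃ t : ℂ, a v = t • v) ∧ (∃ t : ℂ, b v = t • v) ∧ (∃ t : ℂ, c v = t • v) ∧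
      (∃ t : ℂ, d v = t • v) := by
  obtain ⟨h1, h2, h3, h4, h5, h6, hE⟩ := H
  set D : V →ₗ[ℂ] V := a * d - b * c with hDdef
  have hDv : ∀ v, D v = a (d v) - b (c v) := fun v => rfl
  have hDs : Function.Surjective D := fun v => ⟨E v, hE v⟩
  have hDi : Function.Injective D := LinearMap.injective_iff_surjective.mpr hDs
  have hDb : ∀ v, D (b v) = q • b (D v) := by
    intro v
    simp only [hDv, h3, h5, map_smul, h1, map_sub, smul_sub]
  have hcD : ∀ v, c (D v) = q • D (c v) := by
    intro v
    simp only [hDv, h2, h5, h4, map_sub, smul_sub]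
  have hbd : ∀ v, b v = 0 → b (d v) = 0 := by
    intro v hv
    by_cases hq0 : q = 0
    · apply hDi
      rw [hDb, hq0]; simp
    · have := h3 v
      rw [hv, map_zero] at this
      exact (smul_eq_zero.mp this.symm).resolve_left hq0
  have hbc : ∀ v, b v = 0 → b (c v) = 0 := by
    intro v hv
    by_cases hq0 : q = 0
    · apply hDi
      rw [hDb, hq0]; simp
    · have := h5 v
      rw [hv, map_zero] at this
      exact (smul_eq_zero.mp this.symm).resolve_left hq0
  have hba : ∀ v, b v = 0 → b (a v) = 0 := by
    intro v hv; rw [← h1, hv, map_zero]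
  obtain ⟨w, -, hw0, hw⟩ := exists_ker q hq (⊤ : Submodule ℂ V) top_ne_bot b D (by simp) (by simp)
    hDi (Or.inr fun w _ => hDb w)
  have hK : LinearMap.ker b ≠ ⊥ := (Submodule.ne_bot_iff _).mpr ⟨w, hw, hw0⟩
  obtain ⟨w, hwb, hw0, hwc⟩ := exists_ker q hq (LinearMap.ker b) hK c D
    (fun w hw => hbc w hw)
    (fun w hw => by
      have hw' : b w = 0 := hw
      show b (D w) = 0
      rw [hDv, map_sub, hba _ (hbd _ hw'), hbc _ hw']; simp)
    hDi (Or.inl fun w _ => hcD w)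
  have hK2 : LinearMap.ker b ⊓ LinearMap.ker c ≠ ⊥ :=
    (Submodule.ne_bot_iff _).mpr ⟨w, ⟨hwb, hwc⟩, hw0⟩
  obtain ⟨s, w, hwbc, hw0, hwa⟩ := exists_eig _ hK2 a (by
    rintro w ⟨hb, hc⟩
    have hc' : c w = 0 := hc
    refine ⟨hba w hb, ?_⟩
    show c (a w) = 0
    rw [h2, hc']; simp)
  have hK3 : (LinearMap.ker b ⊓ LinearMap.ker c) ⊓ LinearMap.ker (a - s • LinearMap.id) ≠ ⊥ :=
    (Submodule.ne_bot_iff _).mpr ⟨w, ⟨hwbc, by simp [hwa]⟩, hw0⟩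
  obtain ⟨t, w, ⟨⟨hb, hc⟩, ha⟩, hw0, hd⟩ := exists_eig _ hK3 d (by
    rintro w ⟨⟨hb, hc⟩, ha⟩
    have hc' : c w = 0 := hc
    have ha' : a w = s • w := by simpa [sub_eq_zero] using ha
    refine ⟨⟨hbd w hb, ?_⟩, ?_⟩
    · show c (d w) = 0
      rw [h4, hc', map_zero]
    · have := h6 w
      rw [hc', map_zero, smul_zero, sub_eq_zero, ha', map_smul] at this
      simp [← this])
  have hb' : b w = 0 := hb
  have hc' : c w = 0 := hc
  have ha' : a w = s • w := by simpa [sub_eq_zero] using ha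
  exact ⟨w, hw0, ⟨s, ha'⟩, ⟨0, by simp [hb']⟩, ⟨0, by simp [hc']⟩, ⟨t, hd⟩⟩

def Tri {V : Type} [AddCommGroup V] [Module ℂ V] {n : ℕ} (e : Basis (Fin n) ℂ V)
    (T : V →ₗ[ℂ] V) : Prop := ∀ i j : Fin n, j < i → e.repr (T (e j)) i = 0

lemma main (q : ℂ) (hq : ∀ m : ℕ, 0 < m → q ^ m ≠ 1) (n : ℕ) :
    ∀ (V : Type) [AddCommGroup V] [Module ℂ V] [FiniteDimensional ℂ V],
    finrank ℂ V = n → ∀ a b c d E : V →ₗ[ℂ] V, Rel q a b c d E →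
    ∃ e : Basis (Fin n) ℂ V, Tri e a ∧ Tri e b ∧ Tri e c ∧ Tri e d := by
  induction n with
  | zero =>
    intro V _ _ _ hV a b c d E H
    exact ⟨finBasisOfFinrankEq ℂ V hV, fun i => i.elim0, fun i => i.elim0, fun i => i.elim0,
      fun i => i.elim0⟩
  | succ n ih =>
    intro V _ _ _ hV a b c d E H
    have : Nontrivial V := nontrivial_of_finrank_pos (R := ℂ) (by omega)
    obtain ⟨v, hv0, ha, hb, hc, hd⟩ := common_eig q hq H
    obtain ⟨N, hN⟩ := Submodule.exists_isCompl (Submodule.span ℂ {v})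
    have hNr : finrank ℂ N = n := by
      have := Submodule.finrank_add_eq_of_isCompl hN
      rw [finrank_span_singleton hv0] at this
      omega
    set p : V →ₗ[ℂ] N := Submodule.projectionOnto N (Submodule.span ℂ {v}) hN.symm with hp
    have hpv : p v = 0 := by
      rw [hp, Submodule.projectionOnto_apply_eq_zero_iff]
      exact Submodule.mem_span_singleton_self v
    have hpN : ∀ x : N, p x = x := fun x => Submodule.projectionOnto_apply_left hN.symm x
    have hker : ∀ x : V, ∃ t : ℂ, x = t • v + (p x : V) := by
      intro x
      have : p (x - (p x : V)) = 0 := by rw [map_sub, hpN, sub_self]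
      rw [hp, Submodule.projectionOnto_apply_eq_zero_iff, Submodule.mem_span_singleton,
        ← hp] at this
      obtain ⟨t, ht⟩ := this
      exact ⟨t, by rw [ht]; abel⟩
    have key : ∀ T : V →ₗ[ℂ] V, (∃ t : ℂ, T v = t • v) → ∀ x : V, p (T (p x : V)) = p (T x) := by
      rintro T ⟨t, ht⟩ x
      obtain ⟨s, hs⟩ := hker x
      conv_rhs => rw [hs]
      simp [ht, hpv]
    have H' : Rel q (p ∘ₗ a ∘ₗ N.subtype) (p ∘ₗ b ∘ₗ N.subtype) (p ∘ₗ c ∘ₗ N.subtype)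
        (p ∘ₗ d ∘ₗ N.subtype) (p ∘ₗ E ∘ₗ N.subtype) := by
      have ka := key a ha
      have kb := key b hb
      have kc := key c hc
      have kd := key d hd
      constructor
      · intro x; simp [ka, kb, H.h1]
      · intro x; simp [ka, kc, H.h2]
      · intro x; simp [kd, kb, H.h3]
      · intro x; simp [kc, kd, H.h4]
      · intro x; simp [kc, kb, H.h5]
      · intro x
        simp only [LinearMap.comp_apply, Submodule.subtype_apply, ka, kb, kd, ← map_sub,
          ← map_smul, H.h6]
      · intro x
        simp only [LinearMap.comp_apply, Submodule.subtype_apply, ka, kb, kc, kd, ← map_sub, H.hE,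
          hpN]
    obtain ⟨e, ea, eb, ec, ed⟩ := ih N hNr _ _ _ _ _ H'
    have hli : ∀ (t : ℂ), ∀ x ∈ N, t • v + x = 0 → t = 0 := by
      intro t x hx h
      have h2 := congrArg p h
      have h3 : p x = ⟨x, hx⟩ := hpN ⟨x, hx⟩
      rw [map_add, map_smul, hpv, smul_zero, zero_add, h3, map_zero] at h2
      have : x = 0 := congrArg Subtype.val h2
      rw [this, add_zero] at h
      exact (smul_eq_zero.mp h).resolve_right hv0
    have hsp : ∀ z : V, ∃ t : ℂ, z + t • v ∈ N := by
      intro z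
      obtain ⟨t, ht⟩ := hker z
      refine ⟨-t, ?_⟩
      have : z + -t • v = (p z : V) := by
        conv_lhs => rw [ht]
        simp
      rw [this]; exact (p z).2
    set f : Basis (Fin (n+1)) ℂ V := Basis.mkFinCons v e hli hsp with hf
    have f0 : f 0 = v := by simp [hf]
    have fs : ∀ i : Fin n, f i.succ = (e i : V) := by intro i; simp [hf]
    have hr : ∀ x : V, ∀ i : Fin n, f.repr x i.succ = e.repr (p x) i := by
      intro x i
      have : (f.coord i.succ) = (e.coord i) ∘ₗ p := by
        apply f.ext
        intro j
        refine Fin.cases ?_ (fun j => ?_) j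
        · simp only [LinearMap.comp_apply, f0, hpv, map_zero]
          rw [← f0]; simp
        · simp only [LinearMap.comp_apply, fs, hpN]
          rw [← fs]
          simp [Finsupp.single_apply]
      exact LinearMap.congr_fun this x
    have tri : ∀ T : V →ₗ[ℂ] V, (∃ t : ℂ, T v = t • v) → Tri e (p ∘ₗ T ∘ₗ N.subtype) →
        Tri f T := by
      rintro T ⟨t, ht⟩ hT i j hij
      induction i using Fin.cases with
      | zero => exact absurd hij (Fin.not_lt_zero j)
      | succ i =>
        rw [hr]
        induction j using Fin.cases with
        | zero => rw [f0, ht, map_smul, hpv]; simp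
        | succ j =>
          rw [fs]
          exact hT i j (Fin.succ_lt_succ_iff.mp hij)
    exact ⟨f, tri a ha ea, tri b hb eb, tri c hc ec, tri d hd ed⟩

end DipperDonkin

/-- Every finite-dimensional algebra representation of the Dipper–Donkin quantum
`GL₂` with `q` not a root of unity is simultaneously (upper) triangularizable. -/
theorem dipper_donkin_triangularizable
    (q : ℂ) (hq : ∀ m : ℕ, 0 < m → q ^ m ≠ 1)
    (n : ℕ) (hn : 1 ≤ n)
    (C11 C12 C21 C22 : Matrix (Fin n) (Fin n) ℂ)
    (h1 : C11 * C12 = C12 * C11)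
    (h2 : C21 * C11 = q • (C11 * C21))
    (h3 : C22 * C12 = q • (C12 * C22))
    (h4 : C21 * C22 = C22 * C21)
    (h5 : C21 * C12 = q • (C12 * C21))
    (h6 : C22 * C11 - C11 * C22 = (q - 1) • (C12 * C21))
    (hdet : IsUnit (C11 * C22 - C12 * C21)) :
    ∃ u : Matrix (Fin n) (Fin n) ℂ, IsUnit u ∧
      ∀ C ∈ ({C11, C12, C21, C22} : Set (Matrix (Fin n) (Fin n) ℂ)),
        ∀ i j : Fin n, j < i → (u * C * u⁻¹) i j = 0 := by
  obtain ⟨E, hE⟩ := hdet.exists_right_inv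
  have H : DipperDonkin.Rel q (Matrix.toLin' C11) (Matrix.toLin' C12) (Matrix.toLin' C21)
      (Matrix.toLin' C22) (Matrix.toLin' E) := by
    constructor <;> intro v <;>
      simp only [Matrix.toLin'_apply, Matrix.mulVec_mulVec, ← Matrix.smul_mulVec,
        ← Matrix.sub_mulVec]
    · rw [h1]
    · rw [h2]
    · rw [h3]
    · rw [h4]
    · rw [h5]
    · rw [h6]
    · rw [← Matrix.mul_assoc, ← Matrix.mul_assoc, ← Matrix.sub_mul, hE, Matrix.one_mulVec]
  obtain ⟨e, ea, eb, ec, ed⟩ := DipperDonkin.main q hq n (Fin n → ℂ) (by simp) _ _ _ _ _ H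
  set s := Pi.basisFun ℂ (Fin n) with hs
  have huv : e.toMatrix s * s.toMatrix e = 1 := e.toMatrix_mul_toMatrix_flip s
  have hinv : (e.toMatrix s)⁻¹ = s.toMatrix e := Matrix.inv_eq_right_inv huv
  have tri : ∀ C : Matrix (Fin n) (Fin n) ℂ, DipperDonkin.Tri e (Matrix.toLin' C) →
      ∀ i j : Fin n, j < i → (e.toMatrix s * C * (e.toMatrix s)⁻¹) i j = 0 := by
    intro C hC i j hij
    have hC' : C = LinearMap.toMatrix s s (Matrix.toLin' C) := by
      rw [hs, LinearMap.toMatrix_eq_toMatrix', LinearMap.toMatrix'_toLin']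
    rw [hinv, hC', basis_toMatrix_mul_linearMap_toMatrix_mul_basis_toMatrix,
      LinearMap.toMatrix_apply]
    exact hC i j hij
  refine ⟨e.toMatrix s, .of_mul_eq_one _ huv, ?_⟩
  intro C hC
  simp only [Set.mem_insert_iff, Set.mem_singleton_iff] at hC
  rcases hC with rfl | rfl | rfl | rfl
  · exact tri _ ea
  · exact tri _ eb
  · exact tri _ ec
  · exact tri _ ed
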